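/- Let H be a real inner product space, X an arbitrary type, φ : X → H a feature map, and define the kernel k(x,z) = ⟨φ(x), φ(z)⟩_H. Assume τ ≥ 0 and k(x,x) ≤ τ for all x ∈ X. Fix n ≥ 1, a sample x₁,…,xₙ ∈ X, R ∈ ℕ, and Λ ≥ 0. For each sign vector ε ∈ {−1,+1}ⁿ let S(ε) denote the supremum, over all coefficient vectors c ∈ ℝ^R with Σ_{r=1}^R |c_r| ≤ Λ and all basis vectors u₁,…,u_R ∈ X, of the real number ⟨ Σ_{r=1}^R c_r φ(u_r), Σ_{i=1}^n ε_i φ(x_i) ⟩_H. Then the empirical Rademacher complexity (1/n) · 2^{−n} · Σ_{ε ∈ {−1,+1}ⁿ} S(ε) is at most √(τ²Λ²/n), i.e. at most τΛ/√n. -/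

import Mathlib

open scoped RealInnerProductSpace BigOperators

/-- The squared norm of a shifted Rademacher sum, summed over all sign vectors. -/
lemma sum_norm_sq_add_signed_sum {H : Type*} [NormedAddCommGroup H] [InnerProductSpace ℝ H]
    {n : ℕ} (a : H) (v : Fin n → H) :
    ∑ ε : Fin n → Bool, ‖a + ∑ i, (if ε i then (1 : ℝ) else -1) • v i‖ ^ 2 =
      2 ^ n * (‖a‖ ^ 2 + ∑ i, ‖v i‖ ^ 2) := by
  induction n generalizing a with
  | zero => simp
  | succ n ih =>
    rw [← (Fin.consEquiv fun _ => Bool).sum_comp, Fintype.sum_prod_type, Fintype.sum_bool]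
    simp only [Fin.consEquiv_apply, Fin.sum_univ_succ, Fin.cons_zero, Fin.cons_succ, if_true,
      Bool.false_eq_true, if_false, ← add_assoc, ih, one_smul, neg_smul, ← sub_eq_add_neg]
    have h := parallelogram_law_with_norm ℝ a (v 0)
    rw [pow_succ]
    linear_combination (2 : ℝ) ^ n * h

/-- The total norm, over all sign vectors, of signed sums of vectors with squared norm at most `τ`. -/
lemma sum_norm_signed_sum_le {H : Type*} [NormedAddCommGroup H] [InnerProductSpace ℝ H]
    {n : ℕ} {v : Fin n → H} {τ : ℝ} (hv : ∀ i, ‖v i‖ ^ 2 ≤ τ) :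
    ∑ ε : Fin n → Bool, ‖∑ i, (if ε i then (1 : ℝ) else -1) • v i‖ ≤ 2 ^ n * √(n * τ) := by
  have hsum : ∑ i, ‖v i‖ ^ 2 ≤ n * τ := by
    simpa using Finset.sum_le_sum fun i (_ : i ∈ Finset.univ) => hv i
  have hnτ : 0 ≤ n * τ := (Finset.sum_nonneg fun i _ => sq_nonneg ‖v i‖).trans hsum
  have hsq := sq_sum_le_card_mul_sum_sq (s := Finset.univ)
    (f := fun ε : Fin n → Bool => ‖∑ i, (if ε i then (1 : ℝ) else -1) • v i‖)
  have hid := sum_norm_sq_add_signed_sum 0 v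
  simp only [zero_add, norm_zero, ne_eq, OfNat.ofNat_ne_zero, not_false_eq_true, zero_pow] at hid
  rw [hid] at hsq
  simp only [Finset.card_univ, Fintype.card_pi, Fintype.card_bool, Finset.prod_const,
    Fintype.card_fin, Nat.cast_pow, Nat.cast_ofNat] at hsq
  refine le_of_abs_le (abs_le_of_sq_le_sq (hsq.trans ?_) (by positivity))
  rw [mul_pow, Real.sq_sqrt hnτ, sq, ← mul_assoc]
  gcongr

/-- Rademacher complexity bound for the SPKM hypothesis class. -/
theorem spkm_rademacher_bound
    {H : Type*} [NormedAddCommGroup H] [InnerProductSpace ℝ H]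
    {X : Type*} (φ : X → H) (k : X → X → ℝ)
    (hk : ∀ x z, k x z = ⟪φ x, φ z⟫)
    (τ : ℝ) (hτ : 0 ≤ τ) (hbound : ∀ x, k x x ≤ τ)
    (n : ℕ) (hn : 1 ≤ n) (x : Fin n → X) (R : ℕ) (Λ : ℝ) (hΛ : 0 ≤ Λ)
    (S : (Fin n → Bool) → ℝ)
    (hS : ∀ ε, S ε = sSup { t : ℝ | ∃ (c : Fin R → ℝ) (u : Fin R → X),
        (∑ r, |c r|) ≤ Λ ∧
        t = ⟪∑ r, c r • φ (u r),
              ∑ i, (if ε i then (1 : ℝ) else -1) • φ (x i)⟫ }) :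
    (n : ℝ)⁻¹ * ((2 : ℝ) ^ n)⁻¹ * ∑ ε : Fin n → Bool, S ε ≤
      Real.sqrt (τ ^ 2 * Λ ^ 2 / n) := by
  have hφ (z : X) : ‖φ z‖ ^ 2 ≤ τ := by
    rw [← real_inner_self_eq_norm_sq, ← hk]
    exact hbound z
  have hS_le (ε : Fin n → Bool) :
      S ε ≤ Λ * √τ * ‖∑ i, (if ε i then (1 : ℝ) else -1) • φ (x i)‖ := by
    rw [hS]
    refine Real.sSup_le ?_ (by positivity)
    rintro t ⟨c, u, hc, rfl⟩
    refine (real_inner_le_norm _ _).trans ?_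
    gcongr
    calc ‖∑ r, c r • φ (u r)‖ ≤ ∑ r, |c r| * √τ := by
          refine norm_sum_le_of_le _ fun r _ => ?_
          rw [norm_smul, Real.norm_eq_abs]
          gcongr
          exact Real.le_sqrt_of_sq_le (hφ _)
      _ ≤ Λ * √τ := by
          rw [← Finset.sum_mul]
          gcongr
  have hn_pos : (0 : ℝ) < n := by exact_mod_cast hn
  calc (n : ℝ)⁻¹ * ((2 : ℝ) ^ n)⁻¹ * ∑ ε : Fin n → Bool, S ε
      ≤ (n : ℝ)⁻¹ * ((2 : ℝ) ^ n)⁻¹ * (Λ * √τ * (2 ^ n * √(n * τ))) := by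
        gcongr
        refine (Finset.sum_le_sum fun ε _ => hS_le ε).trans ?_
        rw [← Finset.mul_sum]
        gcongr
        exact sum_norm_signed_sum_le fun i => hφ (x i)
    _ = τ * Λ / √n := by
        rw [Real.sqrt_mul hn_pos.le]
        have hτ_sq := Real.sq_sqrt hτ
        have hn_sq := Real.sq_sqrt hn_pos.le
        have hn_sqrt : 0 < √(n : ℝ) := Real.sqrt_pos.2 hn_pos
        field_simp
        rw [hτ_sq, hn_sq]
        ring
    _ = √(τ ^ 2 * Λ ^ 2 / n) := by
        rw [Real.sqrt_div (by positivity), ← mul_pow, Real.sqrt_sq (by positivity)]
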